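/- arXiv:2402.06576 — 2 statements merged into one kernel-verified Lean document; each statement's English description precedes it below -/
import Mathlib

section
/- Each value ξ(q) lies in the interval (0, 1]; consequently every incremental benefit δ_j(ℓ) lies in (0, 1], and each μ_j is a valid benefit function: μ_j(0) = 0, μ_j is monotone non-decreasing, μ_j has the diminishing returns property, and every increment μ_j(ℓ) − μ_j(ℓ−1) is at most 1. -/
open Finset

section Leximin

/-- The finite set `F = {p/q : p, q ∈ {1, …, k}, p ≤ q} ∪ {0}` of possible
satisfaction ratios. -/
def Fset (k : ℕ) : Finset ℚ :=
  insert 0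
    ((((Finset.Icc 1 k) ×ˢ (Finset.Icc 1 k)).filter fun pq => pq.1 ≤ pq.2).image
      fun pq => (pq.1 : ℚ) / (pq.2 : ℚ))

/-- The rank `π(q)` of `q` in `F` sorted in descending order (the rank of the largest
element is 1): the number of elements of `F` that are `≥ q`. -/
def rankDesc (k : ℕ) (q : ℚ) : ℕ := ((Fset k).filter fun x => q ≤ x).card

/-- `ξ(q) = N ^ π(q) / N ^ |F|`, where `N = |B| · k`. -/
noncomputable def xi (N k : ℕ) (q : ℚ) : ℝ :=
  (N : ℝ) ^ rankDesc k q / (N : ℝ) ^ (Fset k).card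

variable {B : Type} [Fintype B]

/-- The incremental benefit `δ_j(ℓ) = ξ((ℓ - 1) / ρ_j)` of buyer `j` for
its `ℓ`-th assigned water unit. -/
noncomputable def delta (k : ℕ) (ρ : B → ℕ) (j : B) (l : ℕ) : ℝ :=
  xi (Fintype.card B * k) k (((l : ℚ) - 1) / (ρ j : ℚ))

/-- The benefit function `μ_j(ℓ) = Σ_{ℓ'=1}^{ℓ} δ_j(ℓ')` (so `μ_j(0) = 0`). -/
noncomputable def mu (k : ℕ) (ρ : B → ℕ) (j : B) (l : ℕ) : ℝ :=
  ∑ l' ∈ Finset.Icc 1 l, delta k ρ j l'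

theorem rankDesc_le_card (k : ℕ) (q : ℚ) : rankDesc k q ≤ (Fset k).card :=
  Finset.card_filter_le _ _

theorem rankDesc_antitone (k : ℕ) : Antitone (rankDesc k) := fun _ _ h =>
  Finset.card_le_card (Finset.monotone_filter_right _ fun _ _ hx => h.trans hx)

theorem xi_mem_Ioc {N : ℕ} (hN : 1 ≤ N) (k : ℕ) (q : ℚ) : xi N k q ∈ Set.Ioc (0 : ℝ) 1 := by
  have hN' : (1 : ℝ) ≤ N := by exact_mod_cast hN
  have hpos : (0 : ℝ) < N := by linarith
  refine ⟨div_pos (pow_pos hpos _) (pow_pos hpos _), ?_⟩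
  exact (div_le_one (pow_pos hpos _)).2 (pow_le_pow_right₀ hN' (rankDesc_le_card k q))

theorem xi_antitone {N : ℕ} (hN : 1 ≤ N) (k : ℕ) : Antitone (xi N k) := fun _ _ h =>
  div_le_div_of_nonneg_right
    (pow_le_pow_right₀ (by exact_mod_cast hN) (rankDesc_antitone k h)) (by positivity)

theorem delta_antitone {k : ℕ} (hN : 1 ≤ Fintype.card B * k) (ρ : B → ℕ) (j : B) :
    Antitone (delta k ρ j) := fun l l' h => by
  have h' : (l : ℚ) ≤ l' := by exact_mod_cast h
  exact xi_antitone hN k (by gcongr)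

theorem mu_succ (k : ℕ) (ρ : B → ℕ) (j : B) (l : ℕ) :
    mu k ρ j (l + 1) = mu k ρ j l + delta k ρ j (l + 1) :=
  Finset.sum_Icc_succ_top (by omega) _

/-- each `ξ(q)` with `q ∈ F` lies in `(0, 1]`, hence every incremental
benefit `δ_j(ℓ)` lies in `(0, 1]`, and each `μ_j` is a valid benefit function:
`μ_j(0) = 0`, `μ_j` is monotone non-decreasing, `μ_j` has diminishing returns, and
every increment is at most 1. -/
theorem xi_mem_Ioc_and_mu_valid
    (k : ℕ) {B : Type} [Fintype B] (ρ : B → ℕ)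
    (hρ : ∀ j : B, 1 ≤ ρ j ∧ ρ j ≤ k)
    (hN : 2 ≤ Fintype.card B * k) :
    (∀ q ∈ Fset k, xi (Fintype.card B * k) k q ∈ Set.Ioc (0 : ℝ) 1) ∧
    (∀ j : B, ∀ l : ℕ, 1 ≤ l → l ≤ ρ j → delta k ρ j l ∈ Set.Ioc (0 : ℝ) 1) ∧
    (∀ j : B,
      mu k ρ j 0 = 0 ∧
      (∀ l l' : ℕ, l ≤ l' → l' ≤ ρ j → mu k ρ j l ≤ mu k ρ j l') ∧
      (∀ l : ℕ, 2 ≤ l → l ≤ ρ j →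
        mu k ρ j l - mu k ρ j (l - 1) ≤ mu k ρ j (l - 1) - mu k ρ j (l - 2)) ∧
      (∀ l : ℕ, 1 ≤ l → l ≤ ρ j → mu k ρ j l - mu k ρ j (l - 1) ≤ 1)) := by
  have hN' : 1 ≤ Fintype.card B * k := by omega
  have hδ (j : B) (l : ℕ) : delta k ρ j l ∈ Set.Ioc (0 : ℝ) 1 := xi_mem_Ioc hN' k _
  refine ⟨fun q _ => xi_mem_Ioc hN' k q, fun j l _ _ => hδ j l, fun j => ⟨?_, ?_, ?_, ?_⟩⟩
  · simp [mu]
  · intro l l' h _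
    refine monotone_nat_of_le_succ (fun n => ?_) h
    rw [mu_succ]
    exact le_add_of_nonneg_right (hδ j _).1.le
  · intro l hl _
    obtain ⟨n, rfl⟩ := Nat.exists_eq_add_of_le' hl
    have h := delta_antitone hN' ρ j (Nat.le_succ (n + 1))
    have h₁ := mu_succ k ρ j n
    have h₂ := mu_succ k ρ j (n + 1)
    simp only [Nat.succ_eq_add_one, Nat.add_sub_cancel, Nat.reduceSubDiff] at h h₁ h₂ ⊢
    linarith
  · intro l hl _
    obtain ⟨n, rfl⟩ := Nat.exists_eq_add_of_le' hl
    rw [Nat.add_sub_cancel, mu_succ, add_sub_cancel_left]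
    exact (hδ j _).2

end Leximin
end

section
/- Assume the value functions are monotone (for every seller s, f_s(w^s_i) is non-decreasing in i, and for every buyer b, f_b(w^b_j) is non-increasing in j) and let r : B → ℕ. Consider the linear program over variables z_e ≥ 0 for the edges e of the resources–needs graph G', with constraints that the total z-value of edges incident to each seller unit is at most 1, the total z-value of edges incident to each buyer unit is at most 1, and for each buyer b the total z-value of edges incident to units of b is at least r(b); the objective is to maximize Σ_e α_e z_e, where α_e is the weight of edge e. If this linear program is feasible, then it has an integral optimal solution; consequently there exists a valid trading assignment that assigns at least r(b) water units to each buyer b and whose welfare is at least the welfare of every trading assignment assigning at least r(b) units to each buyer b. -/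
open Finset

section Market

variable {S B : Type} [Fintype S] [Fintype B] [DecidableEq S] [DecidableEq B]

/-- The type of seller water units: unit `i` of seller `s` (0-indexed). -/
abbrev SUnit {S : Type} (gS : S → ℕ) : Type := Σ s : S, Fin (gS s)

/-- The type of buyer water units: unit `j` of buyer `b` (0-indexed). -/
abbrev BUnit {B : Type} (gB : B → ℕ) : Type := Σ b : B, Fin (gB b)

/-- A trading assignment: a finite set of (seller unit, buyer unit) pairs such that
every pair is compatible and every water unit occurs in at most one pair. -/
def IsAssignment (gS : S → ℕ) (gB : B → ℕ) (E : S → B → Prop)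
    (T : Finset (SUnit gS × BUnit gB)) : Prop :=
  (∀ p ∈ T, E p.1.1 p.2.1) ∧
  (∀ p ∈ T, ∀ q ∈ T, p.1 = q.1 → p = q) ∧
  (∀ p ∈ T, ∀ q ∈ T, p.2 = q.2 → p = q)

/-- The value condition: the buyer values each traded unit at least as much as the seller. -/
def ValueCond (gS : S → ℕ) (gB : B → ℕ)
    (fS : ∀ s : S, Fin (gS s) → ℝ) (fB : ∀ b : B, Fin (gB b) → ℝ)
    (T : Finset (SUnit gS × BUnit gB)) : Prop :=
  ∀ p ∈ T, fS p.1.1 p.1.2 ≤ fB p.2.1 p.2.2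

/-- The index `i - 1` (the preceding unit of the same agent). -/
def predIdx {n : ℕ} (j : Fin n) : Fin n :=
  ⟨(j : ℕ) - 1, lt_of_le_of_lt (Nat.sub_le _ _) j.isLt⟩

/-- A seller unit occurs in some pair of `T`. -/
def SellerMatched (gS : S → ℕ) (gB : B → ℕ)
    (T : Finset (SUnit gS × BUnit gB)) (u : SUnit gS) : Prop :=
  ∃ p ∈ T, p.1 = u

/-- A buyer unit occurs in some pair of `T`. -/
def BuyerMatched (gS : S → ℕ) (gB : B → ℕ)
    (T : Finset (SUnit gS × BUnit gB)) (v : BUnit gB) : Prop :=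
  ∃ p ∈ T, p.2 = v

/-- The priority condition: a unit of an agent is matched only if the preceding
unit of the same agent is matched. -/
def PriorityCond (gS : S → ℕ) (gB : B → ℕ)
    (T : Finset (SUnit gS × BUnit gB)) : Prop :=
  (∀ s : S, ∀ i : Fin (gS s), (i : ℕ) ≠ 0 →
    SellerMatched gS gB T ⟨s, i⟩ → SellerMatched gS gB T ⟨s, predIdx i⟩) ∧
  (∀ b : B, ∀ j : Fin (gB b), (j : ℕ) ≠ 0 →
    BuyerMatched gS gB T ⟨b, j⟩ → BuyerMatched gS gB T ⟨b, predIdx j⟩)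

/-- The welfare of a trading assignment. -/
def welfare (gS : S → ℕ) (gB : B → ℕ)
    (fS : ∀ s : S, Fin (gS s) → ℝ) (fB : ∀ b : B, Fin (gB b) → ℝ)
    (T : Finset (SUnit gS × BUnit gB)) : ℝ :=
  ∑ p ∈ T, (fB p.2.1 p.2.2 - fS p.1.1 p.1.2)

/-- Edges of the resources--needs graph `G'`. -/
def IsEdge (gS : S → ℕ) (gB : B → ℕ)
    (fS : ∀ s : S, Fin (gS s) → ℝ) (fB : ∀ b : B, Fin (gB b) → ℝ)
    (E : S → B → Prop) (p : SUnit gS × BUnit gB) : Prop :=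
  E p.1.1 p.2.1 ∧ fS p.1.1 p.1.2 ≤ fB p.2.1 p.2.2

/-- A matching of the resources--needs graph `G'`. -/
def IsMatching (gS : S → ℕ) (gB : B → ℕ)
    (fS : ∀ s : S, Fin (gS s) → ℝ) (fB : ∀ b : B, Fin (gB b) → ℝ)
    (E : S → B → Prop) (M : Finset (SUnit gS × BUnit gB)) : Prop :=
  (∀ p ∈ M, IsEdge gS gB fS fB E p) ∧
  (∀ p ∈ M, ∀ q ∈ M, p.1 = q.1 → p = q) ∧
  (∀ p ∈ M, ∀ q ∈ M, p.2 = q.2 → p = q)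

/-- The total weight of a matching of `G'`. -/
def matchWeight (gS : S → ℕ) (gB : B → ℕ)
    (fS : ∀ s : S, Fin (gS s) → ℝ) (fB : ∀ b : B, Fin (gB b) → ℝ)
    (M : Finset (SUnit gS × BUnit gB)) : ℝ :=
  ∑ p ∈ M, (fB p.2.1 p.2.2 - fS p.1.1 p.1.2)

/-- Feasibility for the LP with matching constraints and, for each buyer `b`, the
lower-bound constraint that the total `z`-value over edges incident to units of `b`
is at least `r b`. Variables are supported on the edges of `G'` and nonnegative. -/
def LPFeasibleB (gS : S → ℕ) (gB : B → ℕ)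
    (fS : ∀ s : S, Fin (gS s) → ℝ) (fB : ∀ b : B, Fin (gB b) → ℝ)
    (E : S → B → Prop) (r : B → ℕ)
    (z : SUnit gS × BUnit gB → ℝ) : Prop :=
  (∀ e, 0 ≤ z e) ∧
  (∀ e, ¬ IsEdge gS gB fS fB E e → z e = 0) ∧
  (∀ u : SUnit gS, ∑ v : BUnit gB, z (u, v) ≤ 1) ∧
  (∀ v : BUnit gB, ∑ u : SUnit gS, z (u, v) ≤ 1) ∧
  (∀ b : B, (r b : ℝ) ≤ ∑ j : Fin (gB b), ∑ u : SUnit gS, z (u, ⟨b, j⟩))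

/-- The LP objective `Σ_e α_e z_e`. -/
def lpObj (gS : S → ℕ) (gB : B → ℕ)
    (fS : ∀ s : S, Fin (gS s) → ℝ) (fB : ∀ b : B, Fin (gB b) → ℝ)
    (z : SUnit gS × BUnit gB → ℝ) : ℝ :=
  ∑ e : SUnit gS × BUnit gB, (fB e.2.1 e.2.2 - fS e.1.1 e.1.2) * z e

/-- The number of water units assigned to buyer `b` by the trading assignment `T`. -/
def assignedCount (gS : S → ℕ) (gB : B → ℕ)
    (T : Finset (SUnit gS × BUnit gB)) (b : B) : ℕ :=
  (T.filter fun p => p.2.1 = b).card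

/-- A nonnegative rectangular matrix whose columns sum to `1` and whose rows sum to at most `1`
has an injective choice of one support entry per column whose cost is at least the cost of the
matrix. -/
theorem exists_injective_of_substochastic {m n : Type} [Fintype m] [Fintype n] [DecidableEq m]
    [DecidableEq n] (A c : m → n → ℝ) (hA : ∀ i j, 0 ≤ A i j)
    (hcol : ∀ j, ∑ i, A i j = 1) (hrow : ∀ i, ∑ j, A i j ≤ 1) :
    ∃ g : n → m, Function.Injective g ∧ (∀ j, A (g j) j ≠ 0) ∧
      ∑ i, ∑ j, c i j * A i j ≤ ∑ j, c (g j) j := by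
  have htotal : ∑ i, ∑ j, A i j = Fintype.card n := by
    rw [sum_comm]; simp [hcol]
  have hcard : Fintype.card n ≤ Fintype.card m := by
    have : ∑ i, ∑ j, A i j ≤ ∑ _i : m, (1 : ℝ) := sum_le_sum fun i _ => hrow i
    rw [htotal] at this
    simpa using this
  obtain ⟨d, hd⟩ := Nat.exists_eq_add_of_le hcard
  have e : n ⊕ Fin d ≃ m := Fintype.equivOfCardEq (by simp [hd])
  have hslack : ∑ i, (1 - ∑ j, A i j) = d := by
    rw [sum_sub_distrib, htotal]; simp [hd]
  have hslack0 : ∀ i, 0 ≤ 1 - ∑ j, A i j := fun i => sub_nonneg.2 (hrow i)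
  let D : Matrix (n ⊕ Fin d) (n ⊕ Fin d) ℝ := fun i =>
    Sum.elim (A (e i)) fun _ => (1 - ∑ j, A (e i) j) / d
  have hD : D ∈ doublyStochastic ℝ (n ⊕ Fin d) := by
    refine mem_doublyStochastic_iff_sum.2 ⟨?_, ?_, ?_⟩
    · rintro i (j | k)
      · exact hA _ _
      · exact div_nonneg (hslack0 _) (Nat.cast_nonneg _)
    · intro i
      rw [Fintype.sum_sum_type]
      simp only [D, Sum.elim_inl, Sum.elim_inr, sum_const, card_univ, Fintype.card_fin,
        nsmul_eq_mul]
      rcases Nat.eq_zero_or_pos d with h | h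
      · have := (sum_eq_zero_iff_of_nonneg fun i _ => hslack0 i).1
          (hslack.trans (by simp [h])) (e i) (mem_univ _)
        simp only [h, Nat.cast_zero, zero_mul]
        linarith
      · have : (d : ℝ) ≠ 0 := by positivity
        field_simp
        ring
    · rintro (j | k)
      · simpa [D] using (e.sum_comp fun i => A i j).trans (hcol j)
      · have h : (d : ℝ) ≠ 0 := by
          have := k.pos
          positivity
        simp only [D, Sum.elim_inr]
        rw [← sum_div, e.sum_comp fun i => 1 - ∑ j, A i j, hslack, div_self h]
  obtain ⟨w, hw0, hw1, hwD⟩ := exists_eq_sum_perm_of_mem_doublyStochastic hD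
  have hperm : ∀ (σ : Equiv.Perm (n ⊕ Fin d)) i j,
      σ.permMatrix ℝ i j = if i = σ.symm j then 1 else 0 := by
    intro σ i j
    simp [PEquiv.toMatrix_apply, Equiv.toPEquiv_apply, Equiv.eq_symm_apply]
  have hDapp : ∀ i j, D i j = ∑ σ, w σ * if i = σ.symm j then 1 else 0 := by
    intro i j
    simp only [← hwD, Matrix.sum_apply, Matrix.smul_apply, smul_eq_mul, hperm]
  let L : Equiv.Perm (n ⊕ Fin d) → ℝ := fun σ => ∑ j, c (e (σ.symm (Sum.inl j))) j
  have hcost : ∑ i, ∑ j, c i j * A i j = ∑ σ, w σ * L σ := by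
    calc ∑ i, ∑ j, c i j * A i j = ∑ j, ∑ i, c (e i) j * D i (Sum.inl j) := by
          rw [sum_comm]
          exact sum_congr rfl fun j _ => (e.sum_comp fun i => c i j * A i j).symm
      _ = ∑ j, ∑ σ, w σ * c (e (σ.symm (Sum.inl j))) j := by
          refine sum_congr rfl fun j _ => ?_
          simp only [hDapp, mul_sum]
          rw [sum_comm]
          refine sum_congr rfl fun σ _ => ?_
          simp [mul_comm]
      _ = ∑ σ, w σ * L σ := by
          rw [sum_comm]
          simp only [L, mul_sum]
  obtain ⟨σ, hσ, hLσ⟩ : ∃ σ, 0 < w σ ∧ ∑ τ, w τ * L τ ≤ L σ := by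
    by_contra! h
    set K := ∑ τ, w τ * L τ with hK
    obtain ⟨τ, hτ⟩ : ∃ τ, 0 < w τ := by
      by_contra! hle
      have : ∑ σ, w σ ≤ 0 := sum_nonpos fun σ _ => hle σ
      linarith
    have hlt : ∑ τ, w τ * L τ < ∑ τ, w τ * K := by
      refine sum_lt_sum (fun σ _ => ?_) ⟨τ, mem_univ _, mul_lt_mul_of_pos_left (h τ hτ) hτ⟩
      rcases (hw0 σ).eq_or_lt with h0 | h0
      · simp [← h0]
      · exact (mul_lt_mul_of_pos_left (h σ h0) h0).le
    rw [← sum_mul, hw1, one_mul] at hlt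
    exact lt_irrefl _ (hK ▸ hlt)
  refine ⟨fun j => e (σ.symm (Sum.inl j)), fun i j hij => by simpa using hij, fun j => ?_,
    hcost.trans_le hLσ⟩
  have hpos : w σ ≤ D (σ.symm (Sum.inl j)) (Sum.inl j) := by
    rw [hDapp]
    refine le_trans (by simp) (single_le_sum (f := fun τ =>
      w τ * if σ.symm (Sum.inl j) = τ.symm (Sum.inl j) then 1 else 0) (fun τ _ => ?_) (mem_univ σ))
    exact mul_nonneg (hw0 τ) (by split_ifs <;> norm_num)
  exact (hσ.trans_le hpos).ne'

/-- Every feasible point of the linear program is dominated by a matching of `G'` that assigns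
at least `r b` units to each buyer `b`. -/
theorem LPFeasibleB.exists_isMatching {gS : S → ℕ} {gB : B → ℕ}
    {fS : ∀ s : S, Fin (gS s) → ℝ} {fB : ∀ b : B, Fin (gB b) → ℝ}
    {E : S → B → Prop} {r : B → ℕ} {z : SUnit gS × BUnit gB → ℝ}
    (hz : LPFeasibleB gS gB fS fB E r z) :
    ∃ M, IsMatching gS gB fS fB E M ∧ (∀ b, r b ≤ assignedCount gS gB M b) ∧
      lpObj gS gB fS fB z ≤ welfare gS gB fS fB M := by
  obtain ⟨hz0, hzE, hzS, hzB, hzr⟩ := hz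
  have hslack : ∀ b, ∑ j : Fin (gB b), (1 - ∑ u, z (u, ⟨b, j⟩)) ≤ gB b - r b := by
    intro b
    rw [sum_sub_distrib, sum_const, card_univ, Fintype.card_fin, nsmul_one]
    exact sub_le_sub_left (hzr b) _
  have hslack0 : ∀ v : BUnit gB, 0 ≤ 1 - ∑ u, z (u, v) := fun v => sub_nonneg.2 (hzB v)
  have hr : ∀ b, r b ≤ gB b := by
    intro b
    have h0 : (0 : ℝ) ≤ gB b - r b := (sum_nonneg fun j _ => hslack0 ⟨b, j⟩).trans (hslack b)
    exact_mod_cast sub_nonneg.1 h0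
  have hcast : ∀ b, ((gB b - r b : ℕ) : ℝ) = gB b - r b := fun b => Nat.cast_sub (hr b)
  -- Each buyer `b` gets `gB b - r b` dummy seller units filling the slack of its units.
  let A : SUnit gS ⊕ (Σ b, Fin (gB b - r b)) → BUnit gB → ℝ := fun i v =>
    Sum.elim (fun u => z (u, v))
      (fun k => if k.1 = v.1 then (1 - ∑ u, z (u, v)) / (gB v.1 - r v.1 : ℕ) else 0) i
  let c : SUnit gS ⊕ (Σ b, Fin (gB b - r b)) → BUnit gB → ℝ := fun i v =>
    Sum.elim (fun u => fB v.1 v.2 - fS u.1 u.2) (fun _ => 0) i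
  have hA : ∀ i v, 0 ≤ A i v := by
    rintro (u | k) v
    · exact hz0 _
    · simp only [A, Sum.elim_inr]
      split_ifs
      · exact div_nonneg (hslack0 v) (Nat.cast_nonneg _)
      · exact le_rfl
  have hcol : ∀ v, ∑ i, A i v = 1 := by
    rintro ⟨b, j⟩
    have hdummy : ∑ k : Σ b, Fin (gB b - r b), A (Sum.inr k) ⟨b, j⟩ =
        (gB b - r b : ℕ) * ((1 - ∑ u, z (u, ⟨b, j⟩)) / (gB b - r b : ℕ)) := by
      rw [Fintype.sum_sigma, sum_eq_single b]
      · simp [A]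
      · intro b' _ hb'
        simp [A, hb']
      · simp
    rw [Fintype.sum_sum_type, hdummy]
    simp only [A, Sum.elim_inl]
    rcases Nat.eq_zero_or_pos (gB b - r b) with h | h
    · have h0 : ∑ j : Fin (gB b), (1 - ∑ u, z (u, ⟨b, j⟩)) = 0 := by
        refine le_antisymm ((hslack b).trans ?_) (sum_nonneg fun j _ => hslack0 ⟨b, j⟩)
        rw [← hcast, h, Nat.cast_zero]
      have := (sum_eq_zero_iff_of_nonneg fun j _ => hslack0 ⟨b, j⟩).1 h0 j (mem_univ _)
      rw [h, Nat.cast_zero, zero_mul]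
      linarith
    · rw [mul_div_cancel₀ _ (Nat.cast_ne_zero.2 h.ne')]
      ring
  have hrow : ∀ i, ∑ v, A i v ≤ 1 := by
    rintro (u | ⟨b, k⟩)
    · exact hzS u
    · have hpos : (0 : ℝ) < (gB b - r b : ℕ) := Nat.cast_pos.2 k.pos
      rw [Fintype.sum_sigma, sum_eq_single b]
      · simp only [A, Sum.elim_inr, if_true]
        rw [← sum_div, div_le_one hpos, hcast]
        exact hslack b
      · intro b' _ hb'
        simp [A, Ne.symm hb']
      · simp
  obtain ⟨g, hg, hgA, hgc⟩ := exists_injective_of_substochastic A c hA hcol hrow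
  refine ⟨univ.filter fun p => g p.2 = Sum.inl p.1, ⟨?_, ?_, ?_⟩, ?_, ?_⟩
  · rintro ⟨u, v⟩ hp
    have hp : g v = Sum.inl u := by simpa using hp
    by_contra hE
    refine hgA v ?_
    rw [hp]
    exact hzE _ hE
  · rintro ⟨u, v⟩ hp ⟨u', v'⟩ hq (rfl : u = u')
    simp only [mem_filter, mem_univ, true_and] at hp hq
    rw [hg (hp.trans hq.symm)]
  · rintro ⟨u, v⟩ hp ⟨u', v'⟩ hq (rfl : v = v')
    simp only [mem_filter, mem_univ, true_and] at hp hq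
    rw [Sum.inl.inj (hp.symm.trans hq)]
  · intro b
    -- At most `gB b - r b` units of `b` are assigned to dummy units.
    let M := univ.filter fun p : SUnit gS × BUnit gB => g p.2 = Sum.inl p.1
    have hsub : univ.image (fun j => g ⟨b, j⟩) ⊆
        (M.filter fun p => p.2.1 = b).image (fun p => Sum.inl p.1) ∪
          univ.image (fun k : Fin (gB b - r b) => Sum.inr ⟨b, k⟩) := by
      intro i hi
      obtain ⟨j, -, rfl⟩ := mem_image.1 hi
      rw [mem_union, mem_image, mem_image]
      rcases hv : g ⟨b, j⟩ with u | ⟨b', k⟩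
      · exact Or.inl ⟨(u, ⟨b, j⟩), by simp [M, hv], rfl⟩
      · obtain rfl : b' = b := by
          by_contra hb
          exact hgA ⟨b, j⟩ (by simp [A, hv, hb])
        exact Or.inr ⟨k, mem_univ _, rfl⟩
    have hle := (card_le_card hsub).trans
      ((card_union_le _ _).trans (add_le_add card_image_le card_image_le))
    rw [card_image_of_injective _ fun j j' h => sigma_mk_injective (hg h), card_univ, card_univ,
      Fintype.card_fin, Fintype.card_fin] at hle
    have := hr b
    change r b ≤ (M.filter fun p => p.2.1 = b).card
    omega
  · refine le_trans (le_of_eq ?_) (hgc.trans (le_of_eq ?_))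
    · simp only [lpObj, c, A, Fintype.sum_sum_type, Fintype.sum_prod_type, Sum.elim_inl,
        Sum.elim_inr, zero_mul, sum_const_zero, add_zero]
    · rw [welfare, sum_filter, Fintype.sum_prod_type_right]
      refine sum_congr rfl fun v _ => ?_
      rcases hv : g v with u | k
      · simp [c, hv]
      · simp [c, hv]

/-- Replacing a pair of a finite set by a new one changes a sum by the difference of the terms. -/
theorem sum_insert_erase_add {α β : Type} [DecidableEq α] [AddCommMonoid β] {M : Finset α}
    {p q : α} (hp : p ∈ M) (hq : q ∉ M.erase p) (φ : α → β) :
    ∑ x ∈ insert q (M.erase p), φ x + φ p = ∑ x ∈ M, φ x + φ q := by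
  rw [sum_insert hq, add_assoc, sum_erase_add _ _ hp, add_comm]

/-- Replacing an edge of a matching by an edge whose endpoints are free. -/
theorem IsMatching.insert_erase {gS : S → ℕ} {gB : B → ℕ}
    {fS : ∀ s : S, Fin (gS s) → ℝ} {fB : ∀ b : B, Fin (gB b) → ℝ} {E : S → B → Prop}
    {M : Finset (SUnit gS × BUnit gB)} (hM : IsMatching gS gB fS fB E M)
    {p q : SUnit gS × BUnit gB} (hq : IsEdge gS gB fS fB E q)
    (h₁ : ∀ x ∈ M.erase p, x.1 ≠ q.1) (h₂ : ∀ x ∈ M.erase p, x.2 ≠ q.2) :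
    IsMatching gS gB fS fB E (insert q (M.erase p)) := by
  obtain ⟨hE, hS, hB⟩ := hM
  refine ⟨?_, ?_, ?_⟩
  · intro x hx
    rcases mem_insert.1 hx with rfl | hx
    exacts [hq, hE x (mem_of_mem_erase hx)]
  · intro x hx y hy hxy
    rcases mem_insert.1 hx with rfl | hx' <;> rcases mem_insert.1 hy with rfl | hy'
    exacts [rfl, (h₁ y hy' hxy.symm).elim, (h₁ x hx' hxy).elim,
      hS x (mem_of_mem_erase hx') y (mem_of_mem_erase hy') hxy]
  · intro x hx y hy hxy
    rcases mem_insert.1 hx with rfl | hx' <;> rcases mem_insert.1 hy with rfl | hy'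
    exacts [rfl, (h₂ y hy' hxy.symm).elim, (h₂ x hx' hxy).elim,
      hB x (mem_of_mem_erase hx') y (mem_of_mem_erase hy') hxy]

/-- If the lower bounds are met by some matching, then with monotone values some matching of
maximum welfare among those meeting the lower bounds satisfies the priority condition. -/
theorem exists_isMatching_priorityCond_max {gS : S → ℕ} {gB : B → ℕ}
    {fS : ∀ s : S, Fin (gS s) → ℝ} {fB : ∀ b : B, Fin (gB b) → ℝ} {E : S → B → Prop}
    (hfS : ∀ s : S, Monotone (fS s)) (hfB : ∀ b : B, Antitone (fB b)) {r : B → ℕ}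
    (hne : ∃ M, IsMatching gS gB fS fB E M ∧ ∀ b, r b ≤ assignedCount gS gB M b) :
    ∃ M, IsMatching gS gB fS fB E M ∧ (∀ b, r b ≤ assignedCount gS gB M b) ∧
      PriorityCond gS gB M ∧
      ∀ M', IsMatching gS gB fS fB E M' → (∀ b, r b ≤ assignedCount gS gB M' b) →
        welfare gS gB fS fB M' ≤ welfare gS gB fS fB M := by
  classical
  let F : Finset (Finset (SUnit gS × BUnit gB)) := univ.filter fun M =>
    IsMatching gS gB fS fB E M ∧ ∀ b, r b ≤ assignedCount gS gB M b
  have hF : ∀ {M}, M ∈ F ↔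
      IsMatching gS gB fS fB E M ∧ ∀ b, r b ≤ assignedCount gS gB M b := by simp [F]
  obtain ⟨M₀, hM₀⟩ := hne
  obtain ⟨M₁, hM₁, hmax₁⟩ := F.exists_max_image (welfare gS gB fS fB) ⟨M₀, hF.2 hM₀⟩
  -- Among the optimal matchings, take one that minimizes the sum of the indices used.
  let ι : SUnit gS × BUnit gB → ℕ := fun p => p.1.2 + p.2.2
  obtain ⟨M, hM, hmin⟩ := (F.filter fun M =>
    welfare gS gB fS fB M₁ ≤ welfare gS gB fS fB M).exists_min_image (fun M => ∑ p ∈ M, ι p)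
    ⟨M₁, mem_filter.2 ⟨hM₁, le_rfl⟩⟩
  obtain ⟨hMF, hMw⟩ := mem_filter.1 hM
  obtain ⟨hmatch, hcount⟩ := hF.1 hMF
  have key : ∀ p ∈ M, ∀ q : SUnit gS × BUnit gB, IsEdge gS gB fS fB E q → q.2.1 = p.2.1 →
      (∀ x ∈ M.erase p, x.1 ≠ q.1) → (∀ x ∈ M.erase p, x.2 ≠ q.2) →
      fB p.2.1 p.2.2 - fS p.1.1 p.1.2 ≤ fB q.2.1 q.2.2 - fS q.1.1 q.1.2 → ι p ≤ ι q := by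
    intro p hp q hq hb h₁ h₂ hw
    have hqM : q ∉ M.erase p := fun h => h₁ q h rfl
    have hι := sum_insert_erase_add hp hqM ι
    have hwel := sum_insert_erase_add hp hqM fun x => fB x.2.1 x.2.2 - fS x.1.1 x.1.2
    have hle := hmin (insert q (M.erase p)) <| mem_filter.2 ⟨hF.2
      ⟨hmatch.insert_erase hq h₁ h₂, fun b => ?_⟩, ?_⟩
    · omega
    · have hc := sum_insert_erase_add hp hqM fun x => if x.2.1 = b then 1 else 0
      rw [← card_filter, ← card_filter, hb, Nat.add_right_cancel_iff] at hc
      exact (hcount b).trans_eq hc.symm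
    · refine hMw.trans ?_
      unfold welfare
      linarith
  refine ⟨M, hmatch, hcount, ⟨?_, ?_⟩, fun M' h h' => (hmax₁ M' (hF.2 ⟨h, h'⟩)).trans hMw⟩
  · rintro s i hi ⟨⟨_, v⟩, hp, rfl⟩
    by_contra hu
    have hlt : ((predIdx i : Fin (gS s)) : ℕ) < i := by simp only [predIdx]; omega
    have hf : fS s (predIdx i) ≤ fS s i := hfS s hlt.le
    have hE := hmatch.1 _ hp
    have := key _ hp (⟨s, predIdx i⟩, v) ⟨hE.1, hf.trans hE.2⟩ rfl
      (fun x hx h => hu ⟨x, mem_of_mem_erase hx, h⟩)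
      (fun x hx h => ne_of_mem_erase hx (hmatch.2.2 x (mem_of_mem_erase hx) _ hp h))
      (sub_le_sub_left hf _)
    simp only [ι] at this
    omega
  · rintro b j hj ⟨⟨u, _⟩, hp, rfl⟩
    by_contra hv
    have hlt : ((predIdx j : Fin (gB b)) : ℕ) < j := by simp only [predIdx]; omega
    have hf : fB b j ≤ fB b (predIdx j) := hfB b hlt.le
    have hE := hmatch.1 _ hp
    have := key _ hp (u, ⟨b, predIdx j⟩) ⟨hE.1, hE.2.trans hf⟩ rfl
      (fun x hx h => ne_of_mem_erase hx (hmatch.2.1 x (mem_of_mem_erase hx) _ hp h))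
      (fun x hx h => hv ⟨x, mem_of_mem_erase hx, h⟩)
      (sub_le_sub_right hf _)
    simp only [ι] at this
    omega

/-- The indicator function of a matching meeting the lower bounds is feasible. -/
theorem IsMatching.lpFeasibleB_indicator {gS : S → ℕ} {gB : B → ℕ}
    {fS : ∀ s : S, Fin (gS s) → ℝ} {fB : ∀ b : B, Fin (gB b) → ℝ} {E : S → B → Prop}
    {r : B → ℕ} {M : Finset (SUnit gS × BUnit gB)} (hM : IsMatching gS gB fS fB E M)
    (hr : ∀ b, r b ≤ assignedCount gS gB M b) :
    LPFeasibleB gS gB fS fB E r fun e => if e ∈ M then 1 else 0 := by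
  refine ⟨fun e => by dsimp only; split_ifs <;> norm_num, fun e he => if_neg fun h => he (hM.1 e h),
    fun u => ?_, fun v => ?_, fun b => ?_⟩
  · rw [← natCast_card_filter, Nat.cast_le_one, card_le_one]
    intro v hv v' hv'
    exact congrArg Prod.snd (hM.2.1 _ (mem_filter.1 hv).2 _ (mem_filter.1 hv').2 rfl)
  · rw [← natCast_card_filter, Nat.cast_le_one, card_le_one]
    intro u hu u' hu'
    exact congrArg Prod.fst (hM.2.2 _ (mem_filter.1 hu).2 _ (mem_filter.1 hu').2 rfl)
  · refine (Nat.cast_le.2 (hr b)).trans_eq ?_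
    have h : M.filter (fun p => p.2.1 = b) = univ.filter fun p => p ∈ M ∧ p.2.1 = b := by
      ext; simp
    rw [assignedCount, h, natCast_card_filter, Fintype.sum_prod_type_right, Fintype.sum_sigma,
      sum_eq_single b]
    · simp
    · intro b' _ hb'
      simp [hb']
    · simp

/-- with monotone value functions, if the LP with per-buyer lower bounds
is feasible then it has an integral optimal solution; consequently there is a valid
trading assignment giving each buyer `b` at least `r b` units whose welfare is at least
that of every such trading assignment. -/
theorem lp_has_integral_optimum
    (gS : S → ℕ) (gB : B → ℕ)
    (fS : ∀ s : S, Fin (gS s) → ℝ) (fB : ∀ b : B, Fin (gB b) → ℝ)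
    (E : S → B → Prop)
    (hfS : ∀ s : S, Monotone (fS s))
    (hfB : ∀ b : B, Antitone (fB b))
    (r : B → ℕ)
    (hfeas : ∃ z : SUnit gS × BUnit gB → ℝ, LPFeasibleB gS gB fS fB E r z) :
    (∃ zstar : SUnit gS × BUnit gB → ℝ,
      LPFeasibleB gS gB fS fB E r zstar ∧
      (∀ e, zstar e = 0 ∨ zstar e = 1) ∧
      (∀ z, LPFeasibleB gS gB fS fB E r z →
        lpObj gS gB fS fB z ≤ lpObj gS gB fS fB zstar)) ∧
    (∃ T : Finset (SUnit gS × BUnit gB),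
      IsAssignment gS gB E T ∧ ValueCond gS gB fS fB T ∧ PriorityCond gS gB T ∧
      (∀ b : B, r b ≤ assignedCount gS gB T b) ∧
      (∀ T' : Finset (SUnit gS × BUnit gB),
        IsAssignment gS gB E T' → ValueCond gS gB fS fB T' → PriorityCond gS gB T' →
        (∀ b : B, r b ≤ assignedCount gS gB T' b) →
        welfare gS gB fS fB T' ≤ welfare gS gB fS fB T)) := by
  obtain ⟨z₀, hz₀⟩ := hfeas
  obtain ⟨M₀, hM₀, hr₀, -⟩ := hz₀.exists_isMatching
  obtain ⟨M, hM, hr, hprio, hmax⟩ :=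
    exists_isMatching_priorityCond_max hfS hfB ⟨M₀, hM₀, hr₀⟩
  refine ⟨⟨_, hM.lpFeasibleB_indicator hr, fun e => (em (e ∈ M)).symm.imp (if_neg ·) (if_pos ·),
    fun z hz => ?_⟩, M, ⟨fun p hp => (hM.1 p hp).1, hM.2⟩, fun p hp => (hM.1 p hp).2, hprio, hr,
    fun T' hT hval _ hr' => hmax T' ⟨fun p hp => ⟨hT.1 p hp, hval p hp⟩, hT.2⟩ hr'⟩
  obtain ⟨M', hM', hr', hle⟩ := hz.exists_isMatching
  refine (hle.trans (hmax M' hM' hr')).trans_eq ?_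
  simp [lpObj, welfare]

end Market
end
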